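/- Let S ∈ B⁰(H) and u ∈ H = L²(ℝⁿ, ℂ). Then sup over X ∈ ℝⁿ × ℝⁿ of ‖(W(Y) − 1) T_X(S) u‖ tends to 0 as Y → 0 in ℝⁿ × ℝⁿ. -/

import Mathlib

open MeasureTheory Filter Topology Matrix
open scoped Pointwise

noncomputable section

/-- Phase space `Ξ = ℝⁿ × (ℝⁿ)*`. -/
abbrev Xi (n : ℕ) := (Fin n → ℝ) × (Fin n → ℝ)

/-- The Hilbert space `H = L²(ℝⁿ, ℂ)`. -/
abbrev Hn (n : ℕ) := Lp ℂ 2 (volume : Measure (Fin n → ℝ))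

/-- `W` is the family of operators given by
`(W(x,ξ)u)(y) = exp(i (y - x/2)·ξ) u(y - x)` (almost everywhere). -/
def IsWeylFamily (n : ℕ) (W : Xi n → (Hn n →L[ℂ] Hn n)) : Prop :=
  ∀ (x ξ : Fin n → ℝ) (u : Hn n), ∀ᵐ y ∂(volume : Measure (Fin n → ℝ)),
    W (x, ξ) u y
      = Complex.exp (Complex.I * (((y - (2⁻¹ : ℝ) • x) ⬝ᵥ ξ : ℝ) : ℂ)) * u (y - x)

/-- Conjugation `T_X(S) := W(X) S W(X)*`. -/
def Tconj (n : ℕ) (W : Xi n → (Hn n →L[ℂ] Hn n)) (X : Xi n)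
    (S : Hn n →L[ℂ] Hn n) : Hn n →L[ℂ] Hn n :=
  W X * S * star (W X)

/-- `B⁰(H)`: the set of `S` whose orbit `X ↦ T_X(S)` is norm-continuous. -/
def B0 (n : ℕ) (W : Xi n → (Hn n →L[ℂ] Hn n)) : Set (Hn n →L[ℂ] Hn n) :=
  {S | Continuous fun X : Xi n => Tconj n W X S}

theorem IsWeylFamily.apply_zero {n : ℕ} {W : Xi n → (Hn n →L[ℂ] Hn n)}
    (hW : IsWeylFamily n W) : W 0 = 1 := by
  ext1 u
  refine Lp.ext ?_
  filter_upwards [hW 0 0 u] with y hy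
  simpa [Prod.mk_zero_zero] using hy

theorem IsWeylFamily.mul_apply_ae {n : ℕ} {W : Xi n → (Hn n →L[ℂ] Hn n)}
    (hW : IsWeylFamily n W) (x ξ y η : Fin n → ℝ) (u : Hn n) :
    ∀ᵐ z ∂(volume : Measure (Fin n → ℝ)), (W (x, ξ) * W (y, η)) u z
      = Complex.exp (Complex.I * (((z - (2⁻¹ : ℝ) • x) ⬝ᵥ ξ : ℝ) : ℂ))
        * (Complex.exp (Complex.I * (((z - x - (2⁻¹ : ℝ) • y) ⬝ᵥ η : ℝ) : ℂ))
          * u (z - x - y)) := by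
  have hshift := (measurePreserving_sub_right (volume : Measure (Fin n → ℝ)) x
    ).quasiMeasurePreserving.ae (hW y η u)
  filter_upwards [hW x ξ (W (y, η) u), hshift] with z hz hz'
  rw [mul_apply_eq_comp, hz, hz']

/-- The canonical commutation relations, in Weyl form. -/
theorem IsWeylFamily.mul_eq_smul_mul {n : ℕ} {W : Xi n → (Hn n →L[ℂ] Hn n)}
    (hW : IsWeylFamily n W) (x ξ y η : Fin n → ℝ) :
    W (x, ξ) * W (y, η)
      = Complex.exp (((y ⬝ᵥ ξ - x ⬝ᵥ η : ℝ) : ℂ) * Complex.I) • (W (y, η) * W (x, ξ)) := by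
  ext1 u
  refine Lp.ext ?_
  rw [_root_.smul_apply]
  filter_upwards [hW.mul_apply_ae x ξ y η u, hW.mul_apply_ae y η x ξ u,
    Lp.coeFn_smul (Complex.exp (((y ⬝ᵥ ξ - x ⬝ᵥ η : ℝ) : ℂ) * Complex.I))
      ((W (y, η) * W (x, ξ)) u)] with z h₁ h₂ h₃
  rw [h₃, Pi.smul_apply, h₁, h₂, smul_eq_mul, sub_right_comm z y x]
  simp only [← mul_assoc, ← Complex.exp_add]
  congr 2
  simp only [sub_dotProduct, smul_dotProduct, smul_eq_mul]
  push_cast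
  ring

theorem IsWeylFamily.Tconj_comm {n : ℕ} {W : Xi n → (Hn n →L[ℂ] Hn n)}
    (hW : IsWeylFamily n W) (X Y : Xi n) (S : Hn n →L[ℂ] Hn n) :
    Tconj n W X (Tconj n W Y S) = Tconj n W Y (Tconj n W X S) := by
  obtain ⟨x, ξ⟩ := X
  obtain ⟨y, η⟩ := Y
  set c : ℂ := Complex.exp (((y ⬝ᵥ ξ - x ⬝ᵥ η : ℝ) : ℂ) * Complex.I)
  have hc : c * star c = 1 := by
    rw [Complex.star_def, Complex.mul_conj, Complex.normSq_eq_norm_sq,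
      Complex.norm_exp_ofReal_mul_I]
    simp
  have hconj : ∀ X Y : Xi n, Tconj n W X (Tconj n W Y S) = W X * W Y * S * star (W X * W Y) := by
    intro X Y
    simp only [Tconj, star_mul, mul_assoc]
  rw [hconj, hconj, hW.mul_eq_smul_mul x ξ y η, star_smul, smul_mul_assoc, smul_mul_smul_comm, hc,
    one_smul]

theorem norm_Tconj {n : ℕ} {W : Xi n → (Hn n →L[ℂ] Hn n)}
    (hWU : ∀ X : Xi n, W X ∈ unitary (Hn n →L[ℂ] Hn n)) (X : Xi n) (S : Hn n →L[ℂ] Hn n) :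
    ‖Tconj n W X S‖ = ‖S‖ := by
  rw [Tconj, CStarRing.norm_mul_mem_unitary _ (Unitary.star_mem (hWU X)),
    CStarRing.norm_mem_unitary_mul _ (hWU X)]

theorem Tconj_sub {n : ℕ} (W : Xi n → (Hn n →L[ℂ] Hn n)) (X : Xi n) (S T : Hn n →L[ℂ] Hn n) :
    Tconj n W X (S - T) = Tconj n W X S - Tconj n W X T := by
  simp only [Tconj, mul_sub, sub_mul]

theorem mul_eq_Tconj_mul {n : ℕ} {W : Xi n → (Hn n →L[ℂ] Hn n)}
    (hWU : ∀ X : Xi n, W X ∈ unitary (Hn n →L[ℂ] Hn n)) (X : Xi n) (S : Hn n →L[ℂ] Hn n) :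
    W X * S = Tconj n W X S * W X := by
  rw [Tconj, mul_assoc, Unitary.star_mul_self_of_mem (hWU X), mul_one]

open scoped ENNReal in
theorem tendsto_eLpNorm_mul_sub_self {α ι : Type*} [MeasurableSpace α] {μ : Measure α}
    {p : ℝ≥0∞} (hp₀ : p ≠ 0) (hp : p ≠ ∞) {l : Filter ι} [l.IsCountablyGenerated]
    {f : α → ℂ} (hf : MemLp f p μ) {e : ι → α → ℂ}
    (he : ∀ i, Measurable (e i)) (hnorm : ∀ i y, ‖e i y‖ ≤ 1)
    (hlim : ∀ y, Tendsto (fun i => e i y) l (𝓝 1)) :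
    Tendsto (fun i => eLpNorm (fun y => e i y * f y - f y) p μ) l (𝓝 0) := by
  have hp_pos : 0 < p.toReal := ENNReal.toReal_pos hp₀ hp
  simp only [eLpNorm_eq_lintegral_rpow_enorm_toReal hp₀ hp]
  suffices h : Tendsto (fun i => ∫⁻ y, ‖e i y * f y - f y‖ₑ ^ p.toReal ∂μ) l (𝓝 0) by
    simpa [hp_pos] using h.ennrpow_const (1 / p.toReal)
  have hbound_fin : ∫⁻ y, ‖2 * f y‖ₑ ^ p.toReal ∂μ ≠ ∞ :=
    (lintegral_rpow_enorm_lt_top_of_eLpNorm_lt_top hp₀ hp (hf.const_mul 2).eLpNorm_lt_top).ne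
  have hdom : Tendsto (fun i => ∫⁻ y, ‖e i y * f y - f y‖ₑ ^ p.toReal ∂μ) l
      (𝓝 (∫⁻ _, 0 ∂μ)) := by
    refine tendsto_lintegral_filter_of_dominated_convergence'
      (fun y => ‖2 * f y‖ₑ ^ p.toReal) (Eventually.of_forall fun i => ?_)
      (Eventually.of_forall fun i => Eventually.of_forall fun y => ?_) hbound_fin
      (Eventually.of_forall fun y => ?_)
    · have := hf.aestronglyMeasurable.aemeasurable
      have := he i
      fun_prop
    · refine ENNReal.rpow_le_rpow (enorm_le_iff_norm_le.2 ?_) hp_pos.le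
      rw [← sub_one_mul, norm_mul, norm_mul]
      refine mul_le_mul_of_nonneg_right ?_ (norm_nonneg _)
      refine (norm_sub_le _ _).trans ?_
      have := hnorm i y
      norm_num
      linarith
    · have h : Tendsto (fun i => e i y * f y - f y) l (𝓝 0) := by
        simpa using ((hlim y).mul_const (f y)).sub_const (f y)
      simpa [hp_pos] using h.enorm.ennrpow_const p.toReal
  simpa using hdom

theorem tendsto_compMeasurePreserving_sub_right {n : ℕ} (u : Hn n) :
    Tendsto (fun x : Fin n → ℝ => Lp.compMeasurePreserving (fun y => y - x)
      (measurePreserving_sub_right volume x) u) (𝓝 0) (𝓝 u) := by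
  let g : C(Fin n → ℝ, C(Fin n → ℝ, Fin n → ℝ)) :=
    (ContinuousMap.mk (fun a : (Fin n → ℝ) × (Fin n → ℝ) => a.2 - a.1) (by fun_prop)).curry
  have h := (continuous_const (y := u)).compMeasurePreservingLp g.continuous
    (fun x => measurePreserving_sub_right volume x) (by simp)
  have h₀ : Lp.compMeasurePreserving (g 0) (measurePreserving_sub_right volume 0) u = u := by
    refine Lp.ext ?_
    filter_upwards [Lp.coeFn_compMeasurePreserving u
      (measurePreserving_sub_right (volume : Measure (Fin n → ℝ)) 0)] with y hy
    exact hy.trans (congrArg u (sub_zero y))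
  have ht := h.tendsto 0
  rw [h₀] at ht
  exact ht

/-- The phase factor `y ↦ exp(i (y - x/2)·ξ)` of the Weyl operator `W(x,ξ)`. -/
def weylPhase {n : ℕ} (Y : Xi n) (y : Fin n → ℝ) : ℂ :=
  Complex.exp (Complex.I * (((y - (2⁻¹ : ℝ) • Y.1) ⬝ᵥ Y.2 : ℝ) : ℂ))

theorem continuous_weylPhase {n : ℕ} :
    Continuous fun q : Xi n × (Fin n → ℝ) => weylPhase q.1 q.2 := by
  simp only [weylPhase, dotProduct]
  fun_prop

theorem measurable_weylPhase {n : ℕ} (Y : Xi n) : Measurable (weylPhase Y) :=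
  (continuous_weylPhase.comp (Continuous.prodMk_right Y)).measurable

theorem norm_weylPhase {n : ℕ} (Y : Xi n) (y : Fin n → ℝ) : ‖weylPhase Y y‖ = 1 := by
  rw [weylPhase, mul_comm, Complex.norm_exp_ofReal_mul_I]

theorem tendsto_weylPhase {n : ℕ} (y : Fin n → ℝ) :
    Tendsto (fun Y : Xi n => weylPhase Y y) (𝓝 0) (𝓝 1) := by
  have h : Tendsto (fun Y : Xi n => weylPhase Y y) (𝓝 0) (𝓝 (weylPhase 0 y)) :=
    (continuous_weylPhase.comp (Continuous.prodMk_left y)).tendsto 0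
  simpa only [weylPhase, Prod.snd_zero, dotProduct_zero, Complex.ofReal_zero, mul_zero,
    Complex.exp_zero] using h

theorem IsWeylFamily.eLpNorm_apply_sub_le {n : ℕ} {W : Xi n → (Hn n →L[ℂ] Hn n)}
    (hW : IsWeylFamily n W) (Y : Xi n) (u : Hn n) :
    eLpNorm (W Y u - u : (Fin n → ℝ) → ℂ) 2 volume
      ≤ eLpNorm (Lp.compMeasurePreserving (fun y => y - Y.1)
          (measurePreserving_sub_right volume Y.1) u - u : (Fin n → ℝ) → ℂ) 2 volume
        + eLpNorm (fun y => weylPhase Y y * u y - u y) 2 volume := by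
  have hτ := Lp.coeFn_compMeasurePreserving u
    (measurePreserving_sub_right (volume : Measure (Fin n → ℝ)) Y.1)
  generalize Lp.compMeasurePreserving (fun y => y - Y.1)
    (measurePreserving_sub_right (volume : Measure (Fin n → ℝ)) Y.1) u = v at hτ ⊢
  have hu := Lp.aestronglyMeasurable u
  have he := (measurable_weylPhase Y).aestronglyMeasurable (μ := volume)
  have hsplit : (W Y u - u : (Fin n → ℝ) → ℂ) =ᵐ[volume]
      (fun y => weylPhase Y y * (v y - u y)) + fun y => weylPhase Y y * u y - u y := by
    filter_upwards [hW Y.1 Y.2 u, hτ] with y hy hy'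
    rw [Pi.sub_apply, Pi.add_apply, hy', Function.comp_apply, hy, weylPhase]
    ring
  rw [eLpNorm_congr_ae hsplit]
  refine (eLpNorm_add_le (he.mul ((Lp.aestronglyMeasurable v).sub hu))
    ((he.mul hu).sub hu) one_le_two).trans (add_le_add_left ?_ _)
  refine (eLpNorm_congr_norm_ae (Eventually.of_forall fun y => ?_)).le
  rw [Pi.mul_apply, norm_mul, norm_weylPhase, one_mul]

/-- A Weyl family is strongly continuous at the origin. -/
theorem IsWeylFamily.tendsto_apply {n : ℕ} {W : Xi n → (Hn n →L[ℂ] Hn n)}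
    (hW : IsWeylFamily n W) (u : Hn n) : Tendsto (fun Y : Xi n => W Y u) (𝓝 0) (𝓝 u) := by
  rw [Lp.tendsto_Lp_iff_tendsto_eLpNorm']
  have hmod := tendsto_eLpNorm_mul_sub_self two_ne_zero ENNReal.ofNat_ne_top (Lp.memLp u)
    measurable_weylPhase (fun Y y => (norm_weylPhase Y y).le) tendsto_weylPhase
  have hshift := ((Lp.tendsto_Lp_iff_tendsto_eLpNorm' _ _).1
    (tendsto_compMeasurePreserving_sub_right u)).comp (continuous_fst.tendsto (0 : Xi n))
  have hsum := hshift.add hmod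
  rw [add_zero] at hsum
  exact tendsto_of_tendsto_of_tendsto_of_le_of_le tendsto_const_nhds hsum
    (fun _ => zero_le) fun Y => hW.eLpNorm_apply_sub_le Y u

/-- for `S ∈ B⁰(H)` and `u ∈ H`,
`sup_X ‖(W(Y) - 1) T_X(S) u‖ → 0` as `Y → 0`. -/
theorem statement3 (n : ℕ) (W : Xi n → (Hn n →L[ℂ] Hn n))
    (hW : IsWeylFamily n W) (hWU : ∀ X : Xi n, W X ∈ unitary (Hn n →L[ℂ] Hn n))
    (S : Hn n →L[ℂ] Hn n) (hS : S ∈ B0 n W) (u : Hn n) :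
    Tendsto (fun Y : Xi n => ⨆ X : Xi n, ‖((W Y - 1) * Tconj n W X S) u‖)
      (𝓝 0) (𝓝 0) := by
  have hT : Tendsto (fun Y => Tconj n W Y S) (𝓝 0) (𝓝 S) := by
    have hS' : Continuous fun X : Xi n => Tconj n W X S := hS
    simpa [Tconj, hW.apply_zero] using hS'.tendsto 0
  have hbound : Tendsto (fun Y => ‖Tconj n W Y S - S‖ * ‖u‖ + ‖S‖ * ‖W Y u - u‖)
      (𝓝 0) (𝓝 0) := by
    simpa using ((tendsto_iff_norm_sub_tendsto_zero.1 hT).mul_const ‖u‖).add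
      ((tendsto_iff_norm_sub_tendsto_zero.1 (hW.tendsto_apply u)).const_mul ‖S‖)
  refine squeeze_zero (fun Y => Real.iSup_nonneg fun X => norm_nonneg _)
    (fun Y => ciSup_le fun X => ?_) hbound
  have hsplit : ((W Y - 1) * Tconj n W X S) u
      = Tconj n W X (Tconj n W Y S - S) (W Y u) + Tconj n W X S (W Y u - u) := by
    rw [sub_mul, one_mul, mul_eq_Tconj_mul hWU Y, Tconj_sub, hW.Tconj_comm Y X, map_sub]
    simp
  rw [hsplit]
  refine (norm_add_le _ _).trans (add_le_add ?_ ?_)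
  · refine (ContinuousLinearMap.le_opNorm _ _).trans_eq ?_
    rw [norm_Tconj hWU, ContinuousLinearMap.norm_map_of_mem_unitary (hWU Y)]
  · refine (ContinuousLinearMap.le_opNorm _ _).trans_eq ?_
    rw [norm_Tconj hWU]
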